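/- Let d ≥ 2, m = 1, n = d−1, let k ∈ {1,…,d−1}, and let y = (ξ_1,…,ξ_{d−1}) ∈ M_{1,d−1}(ℝ) be such that 1, ξ_1,…,ξ_k are linearly independent over ℚ. Then for every (d−k)-dimensional linear subspace W ⊂ ℝ^d spanned by vectors of ℤ^d, represented by v_W ∈ ⋀^{d−k} ℤ^d, there exists I ⊂ {1,…,d} of cardinality d−k with 1 ∈ I such that the e_I-component of u(y)v_W in the standard basis of ⋀^{d−k} ℝ^d is nonzero. -/

import Mathlib

open scoped Classical
open MeasureTheory Module Matrix

noncomputable section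

/-- The set of integer vectors in `ℝ^d`. -/
def intVectors (d : ℕ) : Set (Fin d → ℝ) :=
  Set.range fun z : Fin d → ℤ => fun i => (z i : ℝ)

/-- The lattice `g ℤ^d`. -/
def latticeOf {d : ℕ} (g : Matrix (Fin d) (Fin d) ℝ) : Set (Fin d → ℝ) :=
  g.mulVec '' intVectors d

/-- The `i`-th successive minimum of a lattice `Λ ⊆ ℝ^d` with respect to the closed unit
cube (the sup-norm unit ball): the least `r > 0` such that `r C` contains `i` linearly
independent vectors of `Λ`. -/
def succMin (d : ℕ) (Λ : Set (Fin d → ℝ)) (i : ℕ) : ℝ :=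
  sInf {r : ℝ | 0 < r ∧ ∃ v : Fin i → (Fin d → ℝ),
    (∀ j, v j ∈ Λ) ∧ LinearIndependent ℝ v ∧ ∀ j, ‖v j‖ ≤ r}

/-- `ω` is an `(m,n)`-weight vector. -/
def IsWeightVector (m n : ℕ) (ω : Fin (m + n) → ℝ) : Prop :=
  (∀ i, 0 < ω i) ∧
  (∀ i j : Fin (m + n), i ≤ j → (j : ℕ) < m → ω j ≤ ω i) ∧
  (∀ i j : Fin (m + n), m ≤ (i : ℕ) → i ≤ j → ω j ≤ ω i) ∧
  (∑ i ∈ Finset.univ.filter (fun i : Fin (m + n) => (i : ℕ) < m), ω i) = 1 ∧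
  (∑ i ∈ Finset.univ.filter (fun i : Fin (m + n) => m ≤ (i : ℕ)), ω i) = 1

/-- The signed weight: `ω i` for `i < m` (expanding directions) and `-ω i` for `i ≥ m`. -/
def signedWeight (m : ℕ) {d : ℕ} (ω : Fin d → ℝ) (i : Fin d) : ℝ :=
  if (i : ℕ) < m then ω i else -ω i

/-- The diagonal flow `a_t^ω = diag (e^{ω₁ t}, …, e^{ω_m t}, e^{-ω_{m+1} t}, …, e^{-ω_d t})`. -/
def aMat (m : ℕ) {d : ℕ} (ω : Fin d → ℝ) (t : ℝ) : Matrix (Fin d) (Fin d) ℝ :=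
  Matrix.diagonal fun i => Real.exp (signedWeight m ω i * t)

/-- `L_i^ω(Λ, t) = log λ_i (a_t^ω Λ)`. -/
def Lfun (m : ℕ) {d : ℕ} (ω : Fin d → ℝ) (Λ : Set (Fin d → ℝ)) (i : ℕ) (t : ℝ) : ℝ :=
  Real.log (succMin d ((aMat m ω t).mulVec '' Λ) i)

/-- `L^ω(Λ, ⬝)` is connected at `k`: the set `{t ≥ 0 : L_k = L_{k+1}}` is unbounded above. -/
def ConnectedAt (m : ℕ) {d : ℕ} (ω : Fin d → ℝ) (Λ : Set (Fin d → ℝ)) (k : ℕ) : Prop :=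
  ∀ T : ℝ, ∃ t : ℝ, 0 ≤ t ∧ T ≤ t ∧ Lfun m ω Λ k t = Lfun m ω Λ (k + 1) t

/-- `μ_I = ∑_{i ∈ I, i ≤ m} ω_i - ∑_{i ∈ I, i ≥ m+1} ω_i`. -/
def muI (m : ℕ) {d : ℕ} (ω : Fin d → ℝ) (I : Finset (Fin d)) : ℝ :=
  ∑ i ∈ I, signedWeight m ω i

/-- The orthogonal projection `π_I : ℝ^d → ℝ^I`. -/
def coordProj (d : ℕ) (I : Finset (Fin d)) : (Fin d → ℝ) →ₗ[ℝ] (Fin d → ℝ) where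
  toFun v := fun i => if i ∈ I then v i else 0
  map_add' u v := by funext i; by_cases h : i ∈ I <;> simp [h]
  map_smul' c v := by funext i; by_cases h : i ∈ I <;> simp [h]

/-- The coordinate subspace `ℝ^I = span {e_i : i ∈ I}`. -/
def coordSubspace (d : ℕ) (I : Finset (Fin d)) : Submodule ℝ (Fin d → ℝ) :=
  Submodule.span ℝ {v | ∃ i ∈ I, v = Pi.single i (1 : ℝ)}

/-- The coefficient of `e_I` in `w 0 ∧ ⋯ ∧ w (k-1) ∈ ⋀^k ℝ^d`, i.e. the `I`-rows minor
`det (w_{j i})_{j ∈ I, 1 ≤ i ≤ k}`. -/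
def gramCoeff {d k : ℕ} (w : Fin k → Fin d → ℝ) (I : Finset (Fin d)) : ℝ :=
  if h : I.card = k then
    Matrix.det (Matrix.of fun r c : Fin k => w c (I.orderEmbOfFin h r))
  else 0

/-- The minor `det A(I, J)` of a square matrix. -/
def subDet {d : ℕ} (A : Matrix (Fin d) (Fin d) ℝ) (k : ℕ) (I J : Finset (Fin d)) : ℝ :=
  if h : I.card = k ∧ J.card = k then
    Matrix.det (Matrix.of fun r c : Fin k => A (I.orderEmbOfFin h.1 r) (J.orderEmbOfFin h.2 c))
  else 0

/-- The largest eigenvalue of `a_1^ω` appearing in the decomposition of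
`w 0 ∧ ⋯ ∧ w (k-1)` into eigenvectors of `a_1^ω` in `⋀^k ℝ^d`. -/
def largestEigAlong (m : ℕ) {d k : ℕ} (ω : Fin d → ℝ) (w : Fin k → Fin d → ℝ) : ℝ :=
  sSup {r : ℝ | ∃ I : Finset (Fin d), I.card = k ∧ gramCoeff w I ≠ 0 ∧ r = Real.exp (muI m ω I)}

/-- `E_j = span (e_1, …, e_j)` (the first `j` coordinates, 0-indexed internally). -/
def Espan (d : ℕ) (j : ℕ) : Submodule ℝ (Fin d → ℝ) :=
  Submodule.span ℝ {v | ∃ i : Fin d, (i : ℕ) < j ∧ v = Pi.single i (1 : ℝ)}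

/-- `E'_{j+1} = span (e_{j+1}, …, e_m)` (0-indexed: coordinates `≥ j`). -/
def Eprime (m : ℕ) (j : ℕ) : Submodule ℝ (Fin m → ℝ) :=
  Submodule.span ℝ {v | ∃ i : Fin m, j ≤ (i : ℕ) ∧ v = Pi.single i (1 : ℝ)}

/-- `I(W) = {i ∈ {m+1,…,d} : dim (W ∩ E_i) > dim (W ∩ E_{i-1})}`. -/
def Iset (m : ℕ) {d : ℕ} (W : Submodule ℝ (Fin d → ℝ)) : Finset (Fin d) :=
  Finset.univ.filter fun i : Fin d =>
    m ≤ (i : ℕ) ∧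
      finrank ℝ ↥(W ⊓ Espan d (i : ℕ)) < finrank ℝ ↥(W ⊓ Espan d ((i : ℕ) + 1))

/-- `ψ(W) = ∑_{i ∈ I(W)} ω_i`. -/
def psiF (m : ℕ) {d : ℕ} (ω : Fin d → ℝ) (W : Submodule ℝ (Fin d → ℝ)) : ℝ :=
  ∑ i ∈ Iset m W, ω i

/-- `J(W') = {j ∈ {1,…,m} : dim (W' ∩ ⟨e_{j+1},…,e_m⟩) < dim (W' ∩ ⟨e_j,…,e_m⟩)}`. -/
def Jset {m : ℕ} (W' : Submodule ℝ (Fin m → ℝ)) : Finset (Fin m) :=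
  Finset.univ.filter fun j : Fin m =>
    finrank ℝ ↥(W' ⊓ Eprime m ((j : ℕ) + 1)) < finrank ℝ ↥(W' ⊓ Eprime m (j : ℕ))

/-- `φ(W') = ∑_{j ∈ J(W')} ω_j`. -/
def phiF (m n : ℕ) (ω : Fin (m + n) → ℝ) (W' : Submodule ℝ (Fin m → ℝ)) : ℝ :=
  ∑ j ∈ Jset W', ω (Fin.castAdd n j)

/-- `u(x) = [[Iₘ, x], [0, Iₙ]]`. -/
def uMat (m n : ℕ) (x : Matrix (Fin m) (Fin n) ℝ) : Matrix (Fin (m + n)) (Fin (m + n)) ℝ :=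
  Matrix.reindex finSumFinEquiv finSumFinEquiv (Matrix.fromBlocks 1 x 0 1)

/-- `x̃ ∈ M_{m,d}(ℝ)`: the first `m` rows of `u(x)`. -/
def xTil (m n : ℕ) (x : Matrix (Fin m) (Fin n) ℝ) : Matrix (Fin m) (Fin (m + n)) ℝ :=
  Matrix.of fun i j => uMat m n x (Fin.castAdd n i) j

/-- `ker x̃` as a subspace of `ℝ^d`. -/
def kerXtil (m n : ℕ) (x : Matrix (Fin m) (Fin n) ℝ) : Submodule ℝ (Fin (m + n) → ℝ) :=
  LinearMap.ker (xTil m n x).mulVecLin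

/-- The `k`-pencil `P^ω_{W,a,b} = {x : ψ(ker x̃ ∩ W) ≥ a ∧ φ(x̃ W) ≤ b}`. -/
def pencil (m n : ℕ) (ω : Fin (m + n) → ℝ) (W : Submodule ℝ (Fin (m + n) → ℝ)) (a b : ℝ) :
    Set (Matrix (Fin m) (Fin n) ℝ) :=
  {x | a ≤ psiF m ω (kerXtil m n x ⊓ W) ∧ phiF m n ω (W.map (xTil m n x).mulVecLin) ≤ b}

/-- A subspace of `ℝ^d` is rational (defined over `ℚ`) if it is spanned by rational vectors. -/
def IsRationalSubspace {d : ℕ} (W : Submodule ℝ (Fin d → ℝ)) : Prop :=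
  ∃ S : Set (Fin d → ℚ),
    Submodule.span ℝ ((fun q : Fin d → ℚ => fun i => ((q i : ℝ))) '' S) = W

/-- A subset of `M_{m,n}(ℝ)` is Zariski closed if it is the common zero locus of a set of
real polynomials in the matrix entries. -/
def IsZariskiClosed {m n : ℕ} (S : Set (Matrix (Fin m) (Fin n) ℝ)) : Prop :=
  ∃ P : Set (MvPolynomial (Fin m × Fin n) ℝ),
    S = {x | ∀ p ∈ P, MvPolynomial.eval (fun ij => x ij.1 ij.2) p = 0}

/-- View a point of Euclidean space indexed by matrix entries as a matrix. -/
def matOfEuc (m n : ℕ) (z : EuclideanSpace ℝ (Fin m × Fin n)) : Matrix (Fin m) (Fin n) ℝ :=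
  Matrix.of fun i j => z (i, j)

/-- `M` is a `p`-dimensional analytic submanifold: around every point, `M` agrees with the
image of an injective analytic immersion of an open subset of `ℝ^p`. -/
def IsAnalyticSubmanifold {ι : Type*} [Fintype ι] (p : ℕ) (M : Set (EuclideanSpace ℝ ι)) :
    Prop :=
  ∀ z ∈ M, ∃ (U : Set (EuclideanSpace ℝ (Fin p)))
      (f : EuclideanSpace ℝ (Fin p) → EuclideanSpace ℝ ι) (V : Set (EuclideanSpace ℝ ι)),
    IsOpen U ∧ IsOpen V ∧ z ∈ V ∧ AnalyticOnNhd ℝ f U ∧ Set.InjOn f U ∧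
      (∀ u ∈ U, Function.Injective (fderiv ℝ f u)) ∧ f '' U = M ∩ V

/-- A column matrix from a vector. -/
def colMat (m : ℕ) (ξ : Fin m → ℝ) : Matrix (Fin m) (Fin 1) ℝ :=
  Matrix.of fun i _ => ξ i

/-- A row matrix from a vector. -/
def rowMat (n : ℕ) (ξ : Fin n → ℝ) : Matrix (Fin 1) (Fin n) ℝ :=
  Matrix.of fun _ j => ξ j

/-- The minor of `x` with rows `P` and columns `Q`. -/
def minorDet (m n : ℕ) (x : Matrix (Fin m) (Fin n) ℝ) (P : Finset (Fin m))
    (Q : Finset (Fin n)) (h : P.card = Q.card) : ℝ :=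
  Matrix.det (Matrix.of fun r c : Fin P.card =>
    x (P.orderEmbOfFin rfl r) (Q.orderEmbOfFin h.symm c))

/-- `𝓓(𝓡)`: the set of all `p × p` minors of `x` with increasing rows in `{1,…,m}` and
increasing columns in `𝓡`, for `1 ≤ p ≤ min m (d - k)`. -/
def Dset (m n k : ℕ) (x : Matrix (Fin m) (Fin n) ℝ) (R : Finset (Fin n)) : Set ℝ :=
  {r | ∃ (P : Finset (Fin m)) (Q : Finset (Fin n)) (h : P.card = Q.card),
    Q ⊆ R ∧ 1 ≤ P.card ∧ P.card ≤ min m (m + n - k) ∧ r = minorDet m n x P Q h}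

/-- A matrix with linearly independent columns whose row `i₀` is nonzero has a nonvanishing
maximal minor using the row `i₀`. -/
lemma exists_gramCoeff_ne_zero_of_row_ne_zero {d r : ℕ} {w : Fin r → Fin d → ℝ}
    (hw : LinearIndependent ℝ w) {i₀ : Fin d} (hi₀ : ∃ j, w j i₀ ≠ 0) :
    ∃ I : Finset (Fin d), I.card = r ∧ i₀ ∈ I ∧ gramCoeff w I ≠ 0 := by
  let row : Fin d → Fin r → ℝ := fun i j => w j i
  have h₀ : LinearIndepOn ℝ row {i₀} := by
    obtain ⟨j, hj⟩ := hi₀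
    exact LinearIndepOn.singleton fun h => hj (congrFun h j)
  obtain ⟨b, -, hb₀, hbspan, hb⟩ := exists_linearIndepOn_extension h₀ (Set.subset_univ _)
  have hrank : finrank ℝ (Submodule.span ℝ (Set.range row)) = r := by
    have h1 := (Matrix.of w).rank_eq_finrank_span_cols
    have h2 := LinearIndependent.rank_matrix (M := Matrix.of w) hw
    rw [Fintype.card_fin] at h2
    exact h1.symm.trans h2
  have hspan : Submodule.span ℝ (Set.range row) = Submodule.span ℝ (row '' b) := by
    apply le_antisymm
    · rw [Submodule.span_le, ← Set.image_univ]
      exact hbspan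
    · exact Submodule.span_mono (Set.image_subset_range _ _)
  have hcard : b.toFinset.card = r := by
    have h3 := finrank_span_eq_card hb
    rw [← Set.image_eq_range, ← hspan, hrank] at h3
    rw [Set.toFinset_card, h3]
  refine ⟨b.toFinset, hcard, by simpa using hb₀, ?_⟩
  rw [gramCoeff, dif_pos hcard]
  let e : Fin r → b := fun i =>
    ⟨b.toFinset.orderEmbOfFin hcard i,
      Set.mem_toFinset.1 (b.toFinset.orderEmbOfFin_mem hcard i)⟩
  have he : Function.Injective e := fun i j hij =>
    (b.toFinset.orderEmbOfFin hcard).injective (Subtype.mk.inj hij)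
  have hli : LinearIndependent ℝ
      (Matrix.of fun i c : Fin r => w c (b.toFinset.orderEmbOfFin hcard i)).row :=
    hb.comp e he
  rw [Matrix.linearIndependent_rows_iff_isUnit, Matrix.isUnit_iff_isUnit_det] at hli
  exact hli.ne_zero

lemma uMat_mulVec_rowMat_zero {n : ℕ} (ξ : Fin n → ℝ) (v : Fin (1 + n) → ℝ) :
    (uMat 1 n (rowMat n ξ)).mulVec v (Fin.castAdd n 0) =
      v (Fin.castAdd n 0) + ∑ j, ξ j * v (Fin.natAdd 1 j) := by
  simp [Matrix.mulVec, dotProduct, uMat, Fin.sum_univ_add, rowMat]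

lemma uMat_det (m n : ℕ) (x : Matrix (Fin m) (Fin n) ℝ) : (uMat m n x).det = 1 := by
  simp [uMat]

/-- Given `n + 1 - k` rational vectors in `ℚ^{1 + n}`, some nontrivial combination of them is
supported on the first `k + 1` coordinates. -/
lemma exists_combination_supported {n k : ℕ} (hk : k ≤ n)
    (q : Fin (1 + n - k) → Fin (1 + n) → ℚ) :
    ∃ c : Fin (1 + n - k) → ℚ, c ≠ 0 ∧ ∀ i : Fin (1 + n), k < (i : ℕ) → ∑ j, c j * q j i = 0 := by
  let M : Matrix (Fin (n - k)) (Fin (1 + n - k)) ℚ :=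
    Matrix.of fun i j => q j ⟨k + 1 + i, by omega⟩
  have hlt : finrank ℚ (Fin (n - k) → ℚ) < finrank ℚ (Fin (1 + n - k) → ℚ) := by
    simp only [finrank_fin_fun]; omega
  obtain ⟨c, hc, hc0⟩ := (Submodule.ne_bot_iff _).1
    (LinearMap.ker_ne_bot_of_finrank_lt (f := M.mulVecLin) hlt)
  refine ⟨c, hc0, fun i hi => ?_⟩
  have h := congrFun (LinearMap.mem_ker.1 hc) ⟨i - (k + 1), by omega⟩
  have hidx : (⟨k + 1 + (i - (k + 1)), by omega⟩ : Fin (1 + n)) = i := Fin.ext (by simp; omega)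
  simp only [Matrix.mulVecLin_apply, Matrix.mulVec, dotProduct, M, Matrix.of_apply, hidx,
    Pi.zero_apply] at h
  rw [← h]
  exact Finset.sum_congr rfl fun j _ => mul_comm _ _

/-- If `1, ξ_1, …, ξ_k` are rationally independent, a rational vector supported on the first
`k + 1` coordinates on which the form `x_0 + ∑ ξ_j x_j` vanishes is zero. -/
lemma eq_zero_of_linearForm_eq_zero {n k : ℕ} (hk : k ≤ n) {ξ : Fin n → ℝ}
    (hind : LinearIndependent ℚ
      (Fin.cons (1 : ℝ) (fun i : Fin k => ξ (Fin.castLE hk i)) : Fin (k + 1) → ℝ))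
    {x : Fin (1 + n) → ℚ} (hx : ∀ i : Fin (1 + n), k < (i : ℕ) → x i = 0)
    (h : (x (Fin.castAdd n 0) : ℝ) + ∑ j, ξ j * (x (Fin.natAdd 1 j) : ℝ) = 0) : x = 0 := by
  have hsum : ∑ j : Fin n, ξ j * (x (Fin.natAdd 1 j) : ℝ) =
      ∑ j : Fin k, ξ (Fin.castLE hk j) * (x (Fin.natAdd 1 (Fin.castLE hk j)) : ℝ) := by
    symm
    apply Finset.sum_of_injOn (Fin.castLE hk) (Fin.castLE_injective hk).injOn (by simp)
    · intro j _ hj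
      rw [hx _ ?_]
      · simp
      · by_contra hlt
        simp only [Fin.val_natAdd] at hlt
        exact hj ⟨⟨j, by omega⟩, by simp, Fin.ext rfl⟩
    · simp
  have hcoord := Fintype.linearIndependent_iff.1 hind
    (Fin.cons (x (Fin.castAdd n 0)) fun j => x (Fin.natAdd 1 (Fin.castLE hk j))) (by
      rw [hsum] at h
      simpa [Fin.sum_univ_succ, Rat.smul_def, mul_comm] using h)
  funext i
  refine Fin.addCases (fun i => ?_) (fun j => ?_) i
  · obtain rfl := Subsingleton.elim i 0
    simpa using hcoord 0
  · by_cases hj : (j : ℕ) < k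
    · exact hcoord (Fin.succ ⟨j, hj⟩)
    · exact hx _ (by simp; omega)

theorem exists_good_component_row
    (n : ℕ) (hn : 1 ≤ n) (k : ℕ) (hk1 : 1 ≤ k) (hk : k ≤ n)
    (ξ : Fin n → ℝ)
    (hind : LinearIndependent ℚ
      (Fin.cons (1 : ℝ) (fun i : Fin k => ξ (Fin.castLE hk i)) : Fin (k + 1) → ℝ))
    (W : Submodule ℝ (Fin (1 + n) → ℝ)) (hW : Module.finrank ℝ W = 1 + n - k)
    (w : Fin (1 + n - k) → (Fin (1 + n) → ℝ)) (hint : ∀ j i, ∃ z : ℤ, w j i = (z : ℝ))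
    (hspan : Submodule.span ℝ (Set.range w) = W) :
    ∃ I : Finset (Fin (1 + n)), I.card = 1 + n - k ∧ (⟨0, by omega⟩ : Fin (1 + n)) ∈ I ∧
      gramCoeff (fun j => (uMat 1 n (rowMat n ξ)).mulVec (w j)) I ≠ 0 := by
  have hw : LinearIndependent ℝ w := by
    rw [linearIndependent_iff_card_eq_finrank_span, Set.finrank, hspan, hW, Fintype.card_fin]
  have hinj : Function.Injective (uMat 1 n (rowMat n ξ)).mulVec :=
    Matrix.mulVec_injective_of_isUnit ((Matrix.isUnit_iff_isUnit_det _).2 (by simp [uMat_det]))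
  have hu : LinearIndependent ℝ fun j => (uMat 1 n (rowMat n ξ)).mulVec (w j) :=
    hw.map' (uMat 1 n (rowMat n ξ)).mulVecLin (LinearMap.ker_eq_bot.2 hinj)
  refine exists_gramCoeff_ne_zero_of_row_ne_zero hu ?_
  by_contra! hzero
  choose z hz using hint
  obtain ⟨c, hc0, hc⟩ := exists_combination_supported hk fun j i => (z j i : ℚ)
  let x : Fin (1 + n) → ℚ := fun i => ∑ j, c j * z j i
  have hxw : (fun i => (x i : ℝ)) = ∑ j, (c j : ℝ) • w j := by
    funext i
    simp [x, hz]
  have hx : x = 0 := by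
    refine eq_zero_of_linearForm_eq_zero hk hind hc ?_
    have hform := uMat_mulVec_rowMat_zero ξ fun i => (x i : ℝ)
    rw [← hform, hxw, ← Matrix.mulVecLin_apply, map_sum, Finset.sum_apply]
    refine Finset.sum_eq_zero fun j _ => ?_
    rw [map_smul, Pi.smul_apply, Matrix.mulVecLin_apply]
    exact (congrArg _ (hzero j)).trans (smul_zero _)
  refine hc0 (funext fun j => ?_)
  have := Fintype.linearIndependent_iff.1 hw (fun j => (c j : ℝ)) (by
    rw [← hxw, hx]; funext i; simp) j
  exact_mod_cast this

end
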